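/- Let Y be a real Banach space and γ : (0,1) → (0,1) a function with 0 < γ(ε) < ε. Suppose {Y_α : α ∈ Λ} is a nonempty family of linear subspaces of Y, totally ordered by inclusion (nested), such that each Y_α (with the induced norm) has the approximate hyperplane sum property for ℓ∞⁴ with the function γ, and Y equals the closure of ⋃_{α∈Λ} Y_α. Then Y has the approximate hyperplane sum property for ℓ∞⁴ with the function ζ(ε) = γ(ε/2). -/

import Mathlib

/-- `M_Y^4`: quadruples `(y₁,y₂,y₃,y₄)` in the closed unit ball of `Y` such that
`‖y_{i₁} − y_{i₂} + y_{i₃}‖ ≤ 1` for all `i₁ < i₂ < i₃`. -/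
def MY4 {Y : Type*} [NormedAddCommGroup Y] (y : Fin 4 → Y) : Prop :=
  (∀ i, ‖y i‖ ≤ 1) ∧
    ∀ i j k : Fin 4, i < j → j < k → ‖y i - y j + y k‖ ≤ 1

/-- `Y` has the approximate hyperplane sum property for `ℓ∞⁴` with the function `γ`. -/
def AHSpL4With (Y : Type*) [NormedAddCommGroup Y] [NormedSpace ℝ Y] (γ : ℝ → ℝ) : Prop :=
  ∀ ε : ℝ, 0 < ε → ε < 1 →
    (0 < γ ε ∧ γ ε < ε) ∧
    ∀ y : Fin 4 → Y, MY4 y →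
      ∀ A : Finset (Fin 4), A.Nonempty →
        ∀ f : Y →L[ℝ] ℝ, ‖f‖ = 1 →
          (∀ i ∈ A, 1 - γ ε < f (y i)) →
          ∃ z : Fin 4 → Y, MY4 z ∧ (∀ i, ‖z i - y i‖ < ε) ∧
            ‖∑ i ∈ A, z i‖ = (A.card : ℝ)

/-- A quadruple in `M_Y^4` can be approximated by quadruples of `M_Z^4` with `Z` a member of a
directed family of subspaces with dense union. -/
theorem MY4.exists_approx_of_directed {Y : Type*} [NormedAddCommGroup Y] [NormedSpace ℝ Y]
    {Λ : Type*} [Nonempty Λ] {S : Λ → Submodule ℝ Y} (hS : Directed (· ≤ ·) S)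
    (hdense : Dense (⋃ a, (S a : Set Y))) {y : Fin 4 → Y} (hy : MY4 y) {δ : ℝ} (hδ : 0 < δ) :
    ∃ (a : Λ) (v : Fin 4 → S a), MY4 v ∧ ∀ i, ‖(v i : Y) - y i‖ < δ := by
  obtain ⟨η, hη, hηδ⟩ : ∃ η : ℝ, 0 < η ∧ 4 * η = δ := ⟨δ / 4, by positivity, by ring⟩
  have hex : ∀ i, ∃ w ∈ ⋃ a, (S a : Set Y), ‖w - y i‖ < η := fun i => by
    obtain ⟨w, hw, hd⟩ := hdense.exists_dist_lt (y i) hη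
    exact ⟨w, hw, by rwa [dist_comm, dist_eq_norm] at hd⟩
  choose w hw hwy using hex
  simp only [Set.mem_iUnion, SetLike.mem_coe] at hw
  choose b hb using hw
  obtain ⟨a, ha⟩ := hS.finite_le b
  have hpos : 0 < 1 + 3 * η := by positivity
  have hscale : ∀ x : Y, ‖x‖ ≤ 1 + 3 * η → ‖(1 + 3 * η)⁻¹ • x‖ ≤ 1 := fun x hx => by
    rw [norm_smul, norm_inv, Real.norm_of_nonneg hpos.le, inv_mul_le_iff₀ hpos, mul_one]
    exact hx
  refine ⟨a, fun i => (1 + 3 * η)⁻¹ • ⟨w i, ha i (hb i)⟩, ⟨fun i => ?_, fun i j k hij hjk => ?_⟩,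
    fun i => ?_⟩
  · refine hscale (w i) ?_
    have h := norm_add_le (w i - y i) (y i)
    rw [sub_add_cancel] at h
    linarith [hwy i, hy.1 i]
  · rw [← smul_sub, ← smul_add]
    refine hscale (w i - w j + w k) ?_
    have h : w i - w j + w k =
        (y i - y j + y k) + ((w i - y i) - (w j - y j) + (w k - y k)) := by abel
    have h₁ := norm_add_le (y i - y j + y k) ((w i - y i) - (w j - y j) + (w k - y k))
    have h₂ := norm_add_le ((w i - y i) - (w j - y j)) (w k - y k)
    have h₃ := norm_sub_le (w i - y i) (w j - y j)
    rw [h]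
    linarith [hwy i, hwy j, hwy k, hy.2 i j k hij hjk]
  · have h : (1 + 3 * η)⁻¹ • w i - y i = (1 + 3 * η)⁻¹ • ((w i - y i) - (3 * η) • y i) := by
      rw [eq_inv_smul_iff₀ hpos.ne', smul_sub, smul_inv_smul₀ hpos.ne', add_smul, one_smul]
      abel
    change ‖(1 + 3 * η)⁻¹ • w i - y i‖ < δ
    rw [h, norm_smul, norm_inv, Real.norm_of_nonneg hpos.le, inv_mul_lt_iff₀ hpos]
    have h₁ := norm_sub_le (w i - y i) ((3 * η) • y i)
    rw [norm_smul, Real.norm_of_nonneg (by positivity : 0 ≤ 3 * η)] at h₁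
    nlinarith [hwy i, hy.1 i, mul_le_mul_of_nonneg_left (hy.1 i) hη.le]

/-- In a space with the AHSp-`ℓ∞⁴`, the functional may be taken of norm at most one. -/
theorem AHSpL4With.exists_of_norm_le_one {Z : Type*} [NormedAddCommGroup Z] [NormedSpace ℝ Z]
    {γ : ℝ → ℝ} (hZ : AHSpL4With Z γ) {ε : ℝ} (hε : 0 < ε) (hε1 : ε < 1) {y : Fin 4 → Z}
    (hy : MY4 y) {A : Finset (Fin 4)} (hA : A.Nonempty) {f : Z →L[ℝ] ℝ} (hf : ‖f‖ ≤ 1)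
    (hfy : ∀ i ∈ A, 1 - γ ε < f (y i)) :
    ∃ z : Fin 4 → Z, MY4 z ∧ (∀ i, ‖z i - y i‖ < ε) ∧ ‖∑ i ∈ A, z i‖ = (A.card : ℝ) := by
  obtain ⟨⟨-, hγ⟩, h⟩ := hZ ε hε hε1
  have hpos : ∀ i ∈ A, 0 < f (y i) := fun i hi => by linarith [hfy i hi]
  have hf0 : f ≠ 0 := by
    rintro rfl
    obtain ⟨i, hi⟩ := hA
    simpa using hpos i hi
  refine h y hy A hA (‖f‖⁻¹ • f) (by simpa using norm_smul_inv_norm (𝕜 := ℝ) hf0) fun i hi => ?_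
  exact (hfy i hi).trans_le <| le_mul_of_one_le_left (hpos i hi).le <|
    (one_le_inv₀ (norm_pos_iff.2 hf0)).2 hf

/-- If `Y` is the closure of the union of a nested family of subspaces, each having the
AHSp-`ℓ∞⁴` with the same function `γ`, then `Y` has the AHSp-`ℓ∞⁴` with the function
`ζ(ε) = γ(ε/2)`. -/
theorem stmt18 (Y : Type*) [NormedAddCommGroup Y] [NormedSpace ℝ Y] [CompleteSpace Y]
    (γ : ℝ → ℝ) {Λ : Type*} [Nonempty Λ] (Ysub : Λ → Submodule ℝ Y)
    (hnested : ∀ a b : Λ, Ysub a ≤ Ysub b ∨ Ysub b ≤ Ysub a)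
    (hAH : ∀ a : Λ, AHSpL4With (Ysub a) γ)
    (hdense : closure (⋃ a : Λ, (Ysub a : Set Y)) = Set.univ) :
    AHSpL4With Y (fun ε => γ (ε / 2)) := by
  intro ε hε hε1
  obtain ⟨a₀⟩ := ‹Nonempty Λ›
  obtain ⟨⟨hγ0, hγ⟩, -⟩ := hAH a₀ (ε / 2) (by linarith) (by linarith)
  refine ⟨⟨hγ0, by linarith⟩, fun y hy A hA f hf hfy => ?_⟩
  have hdir : Directed (· ≤ ·) Ysub := fun a b =>
    (hnested a b).elim (fun h => ⟨b, h, le_rfl⟩) fun h => ⟨a, le_rfl, h⟩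
  obtain ⟨δ, hδ, hδε, hδf⟩ :
      ∃ δ : ℝ, 0 < δ ∧ δ ≤ ε / 2 ∧ ∀ i ∈ A, δ ≤ f (y i) - (1 - γ (ε / 2)) := by
    obtain ⟨j, hj, hmin⟩ := A.exists_min_image (fun i => f (y i)) hA
    refine ⟨min (ε / 2) (f (y j) - (1 - γ (ε / 2))), lt_min (by linarith) (sub_pos.2 (hfy j hj)),
      min_le_left _ _, fun i hi => (min_le_right _ _).trans (sub_le_sub_right (hmin i hi) _)⟩
  obtain ⟨a, v, hv, hvy⟩ :=
    hy.exists_approx_of_directed hdir (dense_iff_closure_eq.2 hdense) hδ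
  have hfa : ‖f.comp (Ysub a).subtypeL‖ ≤ 1 := by
    refine ContinuousLinearMap.opNorm_le_bound _ zero_le_one fun x => ?_
    simpa [hf] using f.le_opNorm (x : Y)
  obtain ⟨z, hz, hzv, hsum⟩ := (hAH a).exists_of_norm_le_one (by linarith : 0 < ε / 2)
    (by linarith) hv hA hfa fun i hi => by
      have h : |f (v i - y i)| < δ := by
        have h := f.le_opNorm (v i - y i)
        rw [hf, one_mul, Real.norm_eq_abs] at h
        exact h.trans_lt (hvy i)
      rw [map_sub] at h
      change 1 - γ (ε / 2) < f (v i)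
      linarith [(abs_lt.1 h).1, hδf i hi]
  refine ⟨fun i => z i, hz, fun i => ?_, ?_⟩
  · have h := norm_add_le ((z i : Y) - v i) (v i - y i)
    rw [sub_add_sub_cancel] at h
    have hzi : ‖(z i : Y) - v i‖ < ε / 2 := hzv i
    linarith [hvy i]
  · rw [← hsum, Submodule.coe_norm, Submodule.coe_sum]
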